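/- Let λ̄ > 0 and ū ∈ H satisfy the eigenvalue relation a(ū, v) = λ̄ b(ū, v) for all v ∈ H. Let G ⊆ S ⊆ H be subspaces and q ∈ H be such that λ̄ · T q ∈ S, and suppose there is a constant Θ ≥ 0 with ‖ū − q‖_b ≤ Θ η_a(G) ‖ū − q‖_a. Then ‖ū − P_S ū‖_a ≤ λ̄ Θ η_a(G)² ‖ū − q‖_a. (Abstract form of the second-order contraction estimates (3.17) and (3.24) at the heart of Theorems 3.1 and 3.2: one step of the augmented subspace iteration reduces the energy error by the factor λ̄ Θ η_a(G)², which is quadratic in the coarse-space approximation quantity η_a(G); in the paper G = W_H is the coarse conforming linear finite element space, q is the previous spectral-projection iterate, and Θ = 1 + 1/(λ_{k+1} δ).) -/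

import Mathlib

open RealInnerProductSpace

/-- A bilinear form that is positive on a finite-dimensional subspace is coercive there. -/
lemma exists_norm_sq_le_mul_of_pos {W : Type*} [NormedAddCommGroup W] [InnerProductSpace ℝ W]
    (H : Submodule ℝ W) [FiniteDimensional ℝ H] (a : LinearMap.BilinForm ℝ W)
    (hpos : ∀ v ∈ H, v ≠ 0 → 0 < a v v) :
    ∃ C : ℝ, 0 ≤ C ∧ ∀ v ∈ H, ‖v‖ ^ 2 ≤ C * a v v := by
  have hcont : Continuous fun v : H => a v v :=
    (LinearMap.toContinuousBilinearMap (a.domRestrict₁₂ H H)).continuous.clm_apply continuous_id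
  rcases subsingleton_or_nontrivial H with hH | hH
  · refine ⟨0, le_rfl, fun v hv => ?_⟩
    have h0 : v = 0 := congrArg Subtype.val (Subsingleton.elim (⟨v, hv⟩ : H) 0)
    simp [h0]
  · obtain ⟨m, hm, hmin⟩ := (isCompact_sphere (0 : H) 1).exists_isMinOn
      (NormedSpace.sphere_nonempty.mpr zero_le_one) hcont.continuousOn
    have hm0 : (m : W) ≠ 0 := by
      intro h
      have : m = 0 := Subtype.ext h
      simp [this] at hm
    have hmpos := hpos m m.2 hm0
    refine ⟨(a m m)⁻¹, by positivity, fun v hv => ?_⟩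
    rcases eq_or_ne v 0 with rfl | hv0
    · simp
    have hn : 0 < ‖v‖ := norm_pos_iff.mpr hv0
    have hle : a m m ≤ a (‖v‖⁻¹ • v) (‖v‖⁻¹ • v) :=
      hmin (a := ‖v‖⁻¹ • (⟨v, hv⟩ : H)) (by simp [norm_smul, hn.ne'])
    simp only [map_smul, LinearMap.smul_apply, smul_eq_mul] at hle
    rw [inv_mul_eq_div, le_div_iff₀ hmpos]
    calc ‖v‖ ^ 2 * a m m ≤ ‖v‖ ^ 2 * (‖v‖⁻¹ * (‖v‖⁻¹ * a v v)) := by gcongr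
      _ = a v v := by field_simp

/-- Two elements of `H` with the same pairings against `H` under a definite form coincide. -/
lemma eq_of_forall_bilin_eq {W : Type*} [AddCommGroup W] [Module ℝ W]
    {H : Submodule ℝ W} {a : LinearMap.BilinForm ℝ W}
    (hpos : ∀ v ∈ H, v ≠ 0 → 0 < a v v) {x y : W} (hx : x ∈ H) (hy : y ∈ H)
    (h : ∀ v ∈ H, a x v = a y v) : x = y := by
  by_contra hne
  have hxy := H.sub_mem hx hy
  have hlt := hpos _ hxy (sub_ne_zero.mpr hne)
  rw [map_sub a, LinearMap.sub_apply, h _ hxy, sub_self] at hlt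
  exact hlt.false

/-- If `e` is orthogonal to `d` and `a d d` is nonnegative, then adding `d` to `e` does not
decrease the energy. -/
lemma bilin_self_le_add_of_orthogonal {W : Type*} [AddCommGroup W] [Module ℝ W]
    {a : LinearMap.BilinForm ℝ W} (hsymm : ∀ x y : W, a x y = a y x) {e d : W}
    (hd : 0 ≤ a d d) (hed : a e d = 0) : a e e ≤ a (e + d) (e + d) := by
  simp only [map_add, LinearMap.add_apply, hsymm d e, hed]
  linarith

/-- The energy norm of the solution operator is bounded on the unit sphere. -/
lemma exists_sqrt_energy_solution_le {W : Type*} [NormedAddCommGroup W] [InnerProductSpace ℝ W]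
    (H : Submodule ℝ W) [FiniteDimensional ℝ H] (a : LinearMap.BilinForm ℝ W)
    (hpos : ∀ v ∈ H, v ≠ 0 → 0 < a v v) (T : W → W) (hTmem : ∀ f : W, T f ∈ H)
    (hT : ∀ f : W, ∀ v ∈ H, a (T f) v = ⟪f, v⟫) :
    ∃ C : ℝ, ∀ f : W, ‖f‖ = 1 → Real.sqrt (a (T f) (T f)) ≤ C := by
  obtain ⟨C, hC, hcoer⟩ := exists_norm_sq_le_mul_of_pos H a hpos
  refine ⟨Real.sqrt C, fun f hf => Real.sqrt_le_sqrt ?_⟩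
  have henergy : a (T f) (T f) ≤ ‖T f‖ := by
    simpa [hT f _ (hTmem f), hf] using real_inner_le_norm f (T f)
  have hsq := (hcoer _ (hTmem f)).trans (mul_le_mul_of_nonneg_left henergy hC)
  by_contra! hlt
  nlinarith

/-- abstract form of the second-order contraction estimates
(3.17) and (3.24). With coarse space `G ⊆ S ⊆ H`, `λ̄ T q ∈ S`, and
`‖ū − q‖_b ≤ Θ η_a(G) ‖ū − q‖_a`, one step of the augmented subspace iteration
satisfies `‖ū − P_S ū‖_a ≤ λ̄ Θ η_a(G)² ‖ū − q‖_a`. -/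
theorem augmented_subspace_second_order_contraction
    {W : Type*} [NormedAddCommGroup W] [InnerProductSpace ℝ W]
    (H S G : Submodule ℝ W) (hGS : G ≤ S) (hSH : S ≤ H) [FiniteDimensional ℝ H]
    (a : LinearMap.BilinForm ℝ W)
    (hsymm : ∀ x y : W, a x y = a y x)
    (hpos : ∀ v ∈ H, v ≠ 0 → 0 < a v v)
    (T : W → W) (hTmem : ∀ f : W, T f ∈ H)
    (hT : ∀ f : W, ∀ v ∈ H, a (T f) v = ⟪f, v⟫)
    (P : W → W) (hPmem : ∀ w ∈ H, P w ∈ S)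
    (hPorth : ∀ w ∈ H, ∀ s ∈ S, a (w - P w) s = 0)
    (ηG : ℝ)
    (hηG : ηG = sSup {r : ℝ | ∃ f : W, ‖f‖ = 1 ∧
      r = sInf {s : ℝ | ∃ v ∈ G, s = Real.sqrt (a (T f - v) (T f - v))}})
    (lambar : ℝ) (hlambar : 0 < lambar)
    (ubar : W) (hubar : ubar ∈ H)
    (heig : ∀ v ∈ H, a ubar v = lambar * ⟪ubar, v⟫)
    (q : W) (hq : q ∈ H) (hTq : lambar • T q ∈ S)
    (Θ : ℝ) (hΘ : 0 ≤ Θ)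
    (hq_dual : ‖ubar - q‖ ≤ Θ * ηG * Real.sqrt (a (ubar - q) (ubar - q))) :
    Real.sqrt (a (ubar - P ubar) (ubar - P ubar)) ≤
      lambar * Θ * ηG ^ 2 * Real.sqrt (a (ubar - q) (ubar - q)) := by
  have hnonneg : ∀ v ∈ H, 0 ≤ a v v := fun v hv => by
    rcases eq_or_ne v 0 with rfl | h
    · simp
    · exact (hpos v hv h).le
  have hbest : ∀ s ∈ S, a (ubar - P ubar) (ubar - P ubar) ≤ a (ubar - s) (ubar - s) := by
    intro s hs
    have hd : P ubar - s ∈ S := S.sub_mem (hPmem ubar hubar) hs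
    simpa using bilin_self_le_add_of_orthogonal hsymm (hnonneg _ (hSH hd))
      (hPorth ubar hubar _ hd)
  have hη0 : 0 ≤ ηG := by
    rw [hηG]
    refine Real.sSup_nonneg ?_
    rintro _ ⟨f, -, rfl⟩
    refine Real.sInf_nonneg ?_
    rintro _ ⟨v, -, rfl⟩
    exact Real.sqrt_nonneg _
  obtain ⟨C, hC⟩ := exists_sqrt_energy_solution_le H a hpos T hTmem hT
  have hη : ∀ f : W, ‖f‖ = 1 →
      sInf {s : ℝ | ∃ v ∈ G, s = Real.sqrt (a (T f - v) (T f - v))} ≤ ηG := by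
    intro f hf
    rw [hηG]
    refine le_csSup ⟨C, ?_⟩ ⟨f, hf, rfl⟩
    rintro _ ⟨g, hg, rfl⟩
    have hbdd : BddBelow {s : ℝ | ∃ v ∈ G, s = Real.sqrt (a (T g - v) (T g - v))} := by
      refine ⟨0, ?_⟩
      rintro _ ⟨v, -, rfl⟩
      exact Real.sqrt_nonneg _
    exact csInf_le_of_le hbdd ⟨0, G.zero_mem, rfl⟩ (by simpa using hC g hg)
  have hresidual : ∀ (c : ℝ) (f : W), ubar - q = c • f →
      ubar - lambar • T q = (lambar * c) • T f := by
    intro c f hcf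
    refine eq_of_forall_bilin_eq hpos (H.sub_mem hubar (hSH hTq)) (H.smul_mem _ (hTmem f)) ?_
    intro v hv
    have hinner : ⟪ubar, v⟫ - ⟪q, v⟫ = c * ⟪f, v⟫ := by
      rw [← inner_sub_left, hcf, real_inner_smul_left]
    simp only [map_sub, map_smul, LinearMap.sub_apply, LinearMap.smul_apply, smul_eq_mul,
      heig v hv, hT _ v hv]
    linear_combination lambar * hinner
  have haubin_nitsche : Real.sqrt (a (ubar - P ubar) (ubar - P ubar)) ≤
      lambar * ηG * ‖ubar - q‖ := by
    rcases eq_or_ne (ubar - q) 0 with h0 | h0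
    · have hres := hresidual 0 0 (by simpa using h0)
      have hle := hbest _ hTq
      rw [hres] at hle
      simp only [mul_zero, zero_smul, map_zero] at hle
      rw [Real.sqrt_eq_zero_of_nonpos hle, h0, norm_zero, mul_zero]
    · have hn : 0 < ‖ubar - q‖ := norm_pos_iff.mpr h0
      set f := ‖ubar - q‖⁻¹ • (ubar - q) with hf
      have hres := hresidual ‖ubar - q‖ f (by rw [hf, smul_inv_smul₀ hn.ne'])
      have hc : 0 < lambar * ‖ubar - q‖ := mul_pos hlambar hn
      suffices h : Real.sqrt (a (ubar - P ubar) (ubar - P ubar)) / (lambar * ‖ubar - q‖) ≤ ηG by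
        rw [div_le_iff₀ hc] at h
        linarith
      refine le_trans ?_ (hη f (by simp [hf, norm_smul, hn.ne']))
      refine le_csInf ⟨_, 0, G.zero_mem, rfl⟩ ?_
      rintro _ ⟨v, hv, rfl⟩
      rw [div_le_iff₀ hc]
      have hle := hbest _ (S.add_mem hTq (S.smul_mem (lambar * ‖ubar - q‖) (hGS hv)))
      rw [← sub_sub, hres, ← smul_sub] at hle
      refine (Real.sqrt_le_sqrt hle).trans_eq ?_
      simp only [map_smul, LinearMap.smul_apply, smul_eq_mul]
      rw [← mul_assoc, Real.sqrt_mul (by positivity), Real.sqrt_mul_self hc.le, mul_comm]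
  calc _ ≤ lambar * ηG * ‖ubar - q‖ := haubin_nitsche
    _ ≤ lambar * ηG * (Θ * ηG * Real.sqrt (a (ubar - q) (ubar - q))) := by gcongr
    _ = _ := by ring
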